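/- Let $K \geq 1$, let $v^1 \in \mathbb{R}^{d_1}, \dots, v^K \in \mathbb{R}^{d_K}$, fix indices $i_k \in \{1,\dots,d_k\}$, and for each $k$ let $\hat{\ell}^k, \hat{r}^k$ be the isotonic regressions of the left and right tails of $v^k$ about the pivot $i_k$. Suppose $c^\ast \in \mathbb{R}$ minimizes the value function $g(c) = \min \{ \sum_k \lVert \hat{v}^k - v^k \rVert^2 : \hat{v}^k \text{ monotone nondecreasing}, \hat{v}^k_{i_k} = c \}$ over $c \in \mathbb{R}$. Define, for each $k$, the vector $v^{\ast k} \in \mathbb{R}^{d_k}$ by clipping: $v^{\ast k}_i = \min(\hat{\ell}^k_i, c^\ast)$ for $i < i_k$, $v^{\ast k}_{i_k} = c^\ast$, and $v^{\ast k}_i = \max(\hat{r}^k_{i - i_k}, c^\ast)$ for $i > i_k$. Then $(v^{\ast k})_{k=1}^K$ is the unique solution of the intersecting isotonic regression problem: it minimizes $\sum_{k=1}^K \lVert \hat{v}^k - v^k \rVert^2$ over all tuples with each $\hat{v}^k$ monotone nondecreasing and $\hat{v}^1_{i_1} = \dots = \hat{v}^K_{i_K}$. -/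

import Mathlib

/-- If `m` has squared error at most that of its perturbation `u + (m - t)`, and `t` lies between
`m` and `u` coordinatewise, then `t` has squared error at most that of `u`. -/
theorem sum_sq_sub_le_of_between {ι : Type*} (s : Finset ι) (m t u w : ι → ℝ)
    (hm : ∑ j ∈ s, (m j - w j) ^ 2 ≤ ∑ j ∈ s, (u j + (m j - t j) - w j) ^ 2)
    (hbetween : ∀ j ∈ s, 0 ≤ (u j - t j) * (t j - m j)) :
    ∑ j ∈ s, (t j - w j) ^ 2 ≤ ∑ j ∈ s, (u j - w j) ^ 2 := by
  have h : ∑ j ∈ s, ((u j - w j) ^ 2 - (t j - w j) ^ 2) =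
      ∑ j ∈ s, (((u j + (m j - t j) - w j) ^ 2 - (m j - w j) ^ 2) +
        2 * ((u j - t j) * (t j - m j))) :=
    Finset.sum_congr rfl fun j _ => by ring
  rw [Finset.sum_add_distrib, Finset.sum_sub_distrib, Finset.sum_sub_distrib,
    ← Finset.mul_sum] at h
  have := Finset.sum_nonneg hbetween
  linarith

/-- Clipping an isotonic regression from above at `c` gives a best monotone fit among those
bounded above by `c`. -/
theorem sum_sq_min_isotonic_le (p q : ℕ) (m u w : ℕ → ℝ) (c : ℝ)
    (hmono : ∀ a b : ℕ, p ≤ a → a ≤ b → b ≤ q → m a ≤ m b)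
    (hmin : ∀ x : ℕ → ℝ, (∀ a b : ℕ, p ≤ a → a ≤ b → b ≤ q → x a ≤ x b) →
      ∑ j ∈ Finset.Icc p q, (m j - w j) ^ 2 ≤ ∑ j ∈ Finset.Icc p q, (x j - w j) ^ 2)
    (humono : ∀ a b : ℕ, p ≤ a → a ≤ b → b ≤ q → u a ≤ u b)
    (huc : ∀ j ∈ Finset.Icc p q, u j ≤ c) :
    ∑ j ∈ Finset.Icc p q, (min (m j) c - w j) ^ 2 ≤ ∑ j ∈ Finset.Icc p q, (u j - w j) ^ 2 := by
  refine sum_sq_sub_le_of_between _ m _ u w (hmin _ fun a b ha hab hb => ?_) fun j hj => ?_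
  · have h1 := hmono a b ha hab hb
    have h2 := humono a b ha hab hb
    rcases min_cases (m a) c with h | h <;> rcases min_cases (m b) c with h' | h' <;> linarith
  · have h1 := huc j hj
    rcases min_cases (m j) c with h | h
    · simp [h.1]
    · rw [h.1]
      exact mul_nonneg_of_nonpos_of_nonpos (by linarith) (by linarith)

/-- Clipping an isotonic regression from below at `c` gives a best monotone fit among those
bounded below by `c`. -/
theorem sum_sq_max_isotonic_le (p q : ℕ) (m u w : ℕ → ℝ) (c : ℝ)
    (hmono : ∀ a b : ℕ, p ≤ a → a ≤ b → b ≤ q → m a ≤ m b)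
    (hmin : ∀ x : ℕ → ℝ, (∀ a b : ℕ, p ≤ a → a ≤ b → b ≤ q → x a ≤ x b) →
      ∑ j ∈ Finset.Icc p q, (m j - w j) ^ 2 ≤ ∑ j ∈ Finset.Icc p q, (x j - w j) ^ 2)
    (humono : ∀ a b : ℕ, p ≤ a → a ≤ b → b ≤ q → u a ≤ u b)
    (huc : ∀ j ∈ Finset.Icc p q, c ≤ u j) :
    ∑ j ∈ Finset.Icc p q, (max (m j) c - w j) ^ 2 ≤ ∑ j ∈ Finset.Icc p q, (u j - w j) ^ 2 := by
  refine sum_sq_sub_le_of_between _ m _ u w (hmin _ fun a b ha hab hb => ?_) fun j hj => ?_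
  · have h1 := hmono a b ha hab hb
    have h2 := humono a b ha hab hb
    rcases max_cases (m a) c with h | h <;> rcases max_cases (m b) c with h' | h' <;> linarith
  · have h1 := huc j hj
    rcases max_cases (m j) c with h | h
    · simp [h.1]
    · rw [h.1]
      exact mul_nonneg (by linarith) (by linarith)

theorem sum_Icc_eq_add_add_of_mem (f : ℕ → ℝ) {i d : ℕ} (hi : 1 ≤ i) (hid : i ≤ d) :
    ∑ j ∈ Finset.Icc 1 d, f j =
      ∑ j ∈ Finset.Icc 1 (i - 1), f j + f i + ∑ j ∈ Finset.Icc (i + 1) d, f j := by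
  have hl : Finset.Icc 1 (i - 1) = Finset.Ico 1 i := by ext; simp; omega
  have hr : Finset.Icc (i + 1) d = Finset.Ico (i + 1) (d + 1) := by ext; simp
  have ht : Finset.Icc 1 d = Finset.Ico 1 (d + 1) := by ext; simp
  rw [hl, hr, ht, ← Finset.sum_Ico_succ_top hi, Finset.sum_Ico_consecutive _ (by omega) (by omega)]

/-- The squared error at the midpoint of two distinct tuples is strictly less than the mean of
their squared errors. -/
theorem two_mul_sum_sq_midpoint_lt (K : ℕ) (d : ℕ → ℕ) (v x y : ℕ → ℕ → ℝ)
    (hne : ∃ k, k < K ∧ ∃ j ∈ Finset.Icc 1 (d k), x k j ≠ y k j) :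
    2 * ∑ k ∈ Finset.range K, ∑ j ∈ Finset.Icc 1 (d k), ((x k j + y k j) / 2 - v k j) ^ 2 <
      ∑ k ∈ Finset.range K, ∑ j ∈ Finset.Icc 1 (d k), (x k j - v k j) ^ 2 +
        ∑ k ∈ Finset.range K, ∑ j ∈ Finset.Icc 1 (d k), (y k j - v k j) ^ 2 := by
  obtain ⟨k, hk, j, hj, hkj⟩ := hne
  have hpt : ∀ k j, 2 * ((x k j + y k j) / 2 - v k j) ^ 2 ≤
      (x k j - v k j) ^ 2 + (y k j - v k j) ^ 2 := fun k j => by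
    nlinarith [sq_nonneg (x k j - y k j)]
  simp only [Finset.mul_sum, ← Finset.sum_add_distrib]
  refine Finset.sum_lt_sum (fun k _ => Finset.sum_le_sum fun j _ => hpt k j)
    ⟨k, Finset.mem_range.2 hk, Finset.sum_lt_sum (fun j _ => hpt k j) ⟨j, hj, ?_⟩⟩
  nlinarith [sq_pos_of_ne_zero (sub_ne_zero.2 hkj)]


/-
STATEMENT 8: if c* minimizes the IISO value function g, then the tuple obtained by
clipping the isotonic regressions of the tails at c* is the unique solution of the
intersecting isotonic regression problem.  Vector k (k < K) has relevant indices
1..(d k) with pivot `idx k`; `lhat k`, `rhat k` are the isotonic regressions of its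
left and right tails (kept at the original indices).
-/
theorem stmt_8 (K : ℕ) (hK : 1 ≤ K) (d : ℕ → ℕ) (v : ℕ → ℕ → ℝ) (idx : ℕ → ℕ)
    (hidx : ∀ k, k < K → 1 ≤ idx k ∧ idx k ≤ d k)
    (lhat rhat : ℕ → ℕ → ℝ)
    -- `lhat k` is the isotonic regression of the left tail of v k:
    (hlmono : ∀ k, k < K → ∀ a b : ℕ, 1 ≤ a → a ≤ b → b ≤ idx k - 1 → lhat k a ≤ lhat k b)
    (hlmin : ∀ k, k < K → ∀ u : ℕ → ℝ,
      (∀ a b : ℕ, 1 ≤ a → a ≤ b → b ≤ idx k - 1 → u a ≤ u b) →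
      ∑ j ∈ Finset.Icc 1 (idx k - 1), (lhat k j - v k j) ^ 2 ≤
        ∑ j ∈ Finset.Icc 1 (idx k - 1), (u j - v k j) ^ 2)
    -- `rhat k` is the isotonic regression of the right tail of v k:
    (hrmono : ∀ k, k < K → ∀ a b : ℕ, idx k + 1 ≤ a → a ≤ b → b ≤ d k → rhat k a ≤ rhat k b)
    (hrmin : ∀ k, k < K → ∀ u : ℕ → ℝ,
      (∀ a b : ℕ, idx k + 1 ≤ a → a ≤ b → b ≤ d k → u a ≤ u b) →
      ∑ j ∈ Finset.Icc (idx k + 1) (d k), (rhat k j - v k j) ^ 2 ≤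
        ∑ j ∈ Finset.Icc (idx k + 1) (d k), (u j - v k j) ^ 2)
    -- g is the (attained) optimal value of the c-constrained IISO problem:
    (g : ℝ → ℝ)
    (hg : ∀ c : ℝ, IsLeast {s : ℝ | ∃ vhat : ℕ → ℕ → ℝ,
      (∀ k, k < K →
        (∀ a b : ℕ, 1 ≤ a → a ≤ b → b ≤ d k → vhat k a ≤ vhat k b) ∧ vhat k (idx k) = c) ∧
      s = ∑ k ∈ Finset.range K, ∑ j ∈ Finset.Icc 1 (d k), (vhat k j - v k j) ^ 2} (g c))
    -- c* minimizes g over ℝ: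
    (cstar : ℝ) (hcstar : ∀ c : ℝ, g cstar ≤ g c)
    -- the clipped tuple v*:
    (vstar : ℕ → ℕ → ℝ)
    (hvstar : ∀ k, k < K → ∀ j : ℕ, vstar k j =
      if j < idx k then min (lhat k j) cstar
      else if j = idx k then cstar
      else max (rhat k j) cstar) :
    -- v* is feasible for the IISO problem:
    ((∀ k, k < K → ∀ a b : ℕ, 1 ≤ a → a ≤ b → b ≤ d k → vstar k a ≤ vstar k b) ∧
     (∀ k k', k < K → k' < K → vstar k (idx k) = vstar k' (idx k'))) ∧
    -- and v* is the unique minimizer among feasible tuples: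
    (∀ u : ℕ → ℕ → ℝ,
      (∀ k, k < K → ∀ a b : ℕ, 1 ≤ a → a ≤ b → b ≤ d k → u k a ≤ u k b) →
      (∀ k k', k < K → k' < K → u k (idx k) = u k' (idx k')) →
      (∑ k ∈ Finset.range K, ∑ j ∈ Finset.Icc 1 (d k), (vstar k j - v k j) ^ 2 ≤
        ∑ k ∈ Finset.range K, ∑ j ∈ Finset.Icc 1 (d k), (u k j - v k j) ^ 2) ∧
      ((∃ k, k < K ∧ ∃ j ∈ Finset.Icc 1 (d k), u k j ≠ vstar k j) →
        ∑ k ∈ Finset.range K, ∑ j ∈ Finset.Icc 1 (d k), (vstar k j - v k j) ^ 2 <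
          ∑ k ∈ Finset.range K, ∑ j ∈ Finset.Icc 1 (d k), (u k j - v k j) ^ 2)) := by
  have hpivot : ∀ k, k < K → vstar k (idx k) = cstar := fun k hk => by simp [hvstar k hk]
  have hmono : ∀ k, k < K → ∀ a b : ℕ, 1 ≤ a → a ≤ b → b ≤ d k → vstar k a ≤ vstar k b := by
    intro k hk a b ha hab hb
    rw [hvstar k hk, hvstar k hk]
    split_ifs
    any_goals omega
    · exact min_le_min_right _ (hlmono k hk a b ha hab (by omega))
    · exact min_le_right _ _
    · exact (min_le_right _ _).trans (le_max_right _ _)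
    · exact le_rfl
    · exact le_max_right _ _
    · exact max_le_max_right _ (hrmono k hk a b (by omega) hab hb)
  have hbest : ∀ u : ℕ → ℕ → ℝ,
      (∀ k, k < K →
        (∀ a b : ℕ, 1 ≤ a → a ≤ b → b ≤ d k → u k a ≤ u k b) ∧ u k (idx k) = cstar) →
      ∑ k ∈ Finset.range K, ∑ j ∈ Finset.Icc 1 (d k), (vstar k j - v k j) ^ 2 ≤
        ∑ k ∈ Finset.range K, ∑ j ∈ Finset.Icc 1 (d k), (u k j - v k j) ^ 2 := by
    intro u hu
    refine Finset.sum_le_sum fun k hkK => ?_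
    have hk := Finset.mem_range.1 hkK
    obtain ⟨hi, hid⟩ := hidx k hk
    obtain ⟨humono, huc⟩ := hu k hk
    rw [sum_Icc_eq_add_add_of_mem _ hi hid, sum_Icc_eq_add_add_of_mem _ hi hid, hpivot k hk, huc]
    have hleft := sum_sq_min_isotonic_le 1 (idx k - 1) (lhat k) (u k) (v k) cstar
      (hlmono k hk) (hlmin k hk)
      (fun a b ha hab hb => humono a b ha hab (by omega)) fun j hj => by
        rw [Finset.mem_Icc] at hj
        exact huc ▸ humono j (idx k) hj.1 (by omega) hid
    have hright := sum_sq_max_isotonic_le (idx k + 1) (d k) (rhat k) (u k) (v k) cstar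
      (hrmono k hk) (hrmin k hk)
      (fun a b ha hab hb => humono a b (by omega) hab hb) fun j hj => by
        rw [Finset.mem_Icc] at hj
        exact huc ▸ humono (idx k) j hi (by omega) hj.2
    refine add_le_add (add_le_add (le_of_eq_of_le ?_ hleft) le_rfl) (le_of_eq_of_le ?_ hright)
    · refine Finset.sum_congr rfl fun j hj => ?_
      rw [Finset.mem_Icc] at hj
      rw [hvstar k hk, if_pos (by omega)]
    · refine Finset.sum_congr rfl fun j hj => ?_
      rw [Finset.mem_Icc] at hj
      rw [hvstar k hk, if_neg (by omega), if_neg (by omega)]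
  have hopt : ∀ u : ℕ → ℕ → ℝ,
      (∀ k, k < K → ∀ a b : ℕ, 1 ≤ a → a ≤ b → b ≤ d k → u k a ≤ u k b) →
      (∀ k k', k < K → k' < K → u k (idx k) = u k' (idx k')) →
      ∑ k ∈ Finset.range K, ∑ j ∈ Finset.Icc 1 (d k), (vstar k j - v k j) ^ 2 ≤
        ∑ k ∈ Finset.range K, ∑ j ∈ Finset.Icc 1 (d k), (u k j - v k j) ^ 2 := by
    intro u humono hupivot
    obtain ⟨x, hx, hgx⟩ := (hg cstar).1
    calc _ ≤ g cstar := hgx ▸ hbest x hx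
      _ ≤ g (u 0 (idx 0)) := hcstar _
      _ ≤ _ := (hg _).2 ⟨u, fun k hk => ⟨humono k hk, hupivot k 0 hk hK⟩, rfl⟩
  have hpivots : ∀ k k', k < K → k' < K → vstar k (idx k) = vstar k' (idx k') :=
    fun k k' hk hk' => (hpivot k hk).trans (hpivot k' hk').symm
  refine ⟨⟨hmono, hpivots⟩, fun u humono hupivot => ⟨hopt u humono hupivot, fun hne => ?_⟩⟩
  have hmid := hopt (fun k j => (u k j + vstar k j) / 2)
    (fun k hk a b ha hab hb => by
      have h1 := humono k hk a b ha hab hb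
      have h2 := hmono k hk a b ha hab hb
      linarith)
    (fun k k' hk hk' => by
      rw [hupivot k k' hk hk', hpivots k k' hk hk'])
  have hlt := two_mul_sum_sq_midpoint_lt K d v u vstar hne
  linarith
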